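/- arXiv:2511.22650 — 2 statements merged into one kernel-verified Lean document; each statement's English description precedes it below -/
import Mathlib

section
/- Let A be a function-valued tensor of size n over H, let I k : Fin (m k) → Fin (n k) be injective index maps (with m k ≥ 1), let G be the subtensor G j = A (fun k => I k (j k)), and let B be any Tucker-cross approximation of A at (I₁,…,I_d) (i.e., B is the Tucker product of G with factor matrices whose rows are least-squares minimizers as specified in the context). Then B interpolates the core: B (fun k => I k (j k)) = G j for every j : (Π k, Fin (m k)); moreover, for every k : Fin d the mode-k rank of B equals the mode-k rank of G. -/
/-- The mode-`k` rank of a function-valued tensor `A : (Π l, Fin (n l)) → H`: the dimension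
of the span of its mode-`k` slices in `(Π l, Fin (n l)) → H`. -/
noncomputable def modeRank {H : Type*} [NormedAddCommGroup H] [InnerProductSpace ℝ H]
    {d : ℕ} {n : Fin d → ℕ} (A : (∀ k : Fin d, Fin (n k)) → H) (k : Fin d) : ℕ :=
  Module.finrank ℝ (Submodule.span ℝ (Set.range fun a : Fin (n k) =>
    fun i : ∀ l : Fin d, Fin (n l) => A (Function.update i k a)))

/-- The `ℓ2(H)`-norm of a finitely indexed family of elements of `H`. -/
noncomputable def l2Norm {H : Type*} [NormedAddCommGroup H] {S : Type*} [Fintype S]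
    (v : S → H) : ℝ :=
  Real.sqrt (∑ s : S, ‖v s‖ ^ 2)

/-- `B` is a Tucker-cross approximation of the function-valued tensor `A` at the index maps
`I k : Fin (m k) → Fin (n k)`: `B` is the Tucker product of the subtensor
`G j = A (fun l => I l (j l))` with factor matrices `F k` each of whose rows is a
least-squares minimizer, in the `ℓ2(H)`-norm, fitting the corresponding restricted
mode-`k` fiber of `A`. -/
def IsTuckerCrossApprox {H : Type*} [NormedAddCommGroup H] [InnerProductSpace ℝ H]
    {d : ℕ} {n m : Fin d → ℕ} (A : (∀ k : Fin d, Fin (n k)) → H)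
    (I : ∀ k : Fin d, Fin (m k) → Fin (n k)) (B : (∀ k : Fin d, Fin (n k)) → H) : Prop :=
  ∃ F : ∀ k : Fin d, Matrix (Fin (n k)) (Fin (m k)) ℝ,
    (∀ (k : Fin d) (i : Fin (n k)) (x : Fin (m k) → ℝ),
      l2Norm (fun j : ∀ l : Fin d, Fin (m l) =>
          (∑ b : Fin (m k), F k i b • A (fun l => I l (Function.update j k b l))) -
            A (Function.update (fun l => I l (j l)) k i)) ≤
      l2Norm (fun j : ∀ l : Fin d, Fin (m l) =>
          (∑ b : Fin (m k), x b • A (fun l => I l (Function.update j k b l))) -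
            A (Function.update (fun l => I l (j l)) k i))) ∧
    (∀ i : ∀ k : Fin d, Fin (n k),
      B i = ∑ j : ∀ l : Fin d, Fin (m l),
        (∏ k : Fin d, F k (i k) (j k)) • A (fun l => I l (j l)))

/-- Summing over a grid point `j` and a new `k`-th coordinate `b` is invariant under exchanging
`b` with `j k`. -/
theorem sum_sum_update_swap {ι M : Type*} [Fintype ι] [DecidableEq ι] {α : ι → Type*}
    [∀ l, Fintype (α l)] [AddCommMonoid M] (k : ι) (g : (∀ l, α l) → α k → M) :
    ∑ j, ∑ b, g (Function.update j k b) (j k) = ∑ j, ∑ b, g j b := by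
  rw [← Fintype.sum_prod_type', ← Fintype.sum_prod_type']
  refine Finset.sum_bij' (fun p _ => (Function.update p.1 k p.2, p.1 k))
    (fun p _ => (Function.update p.1 k p.2, p.1 k)) ?_ ?_ ?_ ?_ ?_ <;> simp

/-- A Tucker contraction, with the contraction over mode `k` carried out first. -/
theorem card_smul_sum_prod_smul {ι H : Type*} [Fintype ι] [DecidableEq ι] {α : ι → Type*}
    [∀ l, Fintype (α l)] [AddCommGroup H] [Module ℝ H] (k : ι)
    (q : ∀ l, α l → ℝ) (G : (∀ l, α l) → H) :
    (Fintype.card (α k) : ℝ) • ∑ j, (∏ l, q l (j l)) • G j =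
      ∑ j, (∏ l ∈ Finset.univ.erase k, q l (j l)) •
        ∑ b, q k b • G (Function.update j k b) := by
  have h := sum_sum_update_swap k (fun (j : ∀ l, α l) (_ : α k) => (∏ l, q l (j l)) • G j)
  simp only [Finset.sum_const, Finset.card_univ] at h
  rw [Finset.smul_sum]
  simp only [Nat.cast_smul_eq_nsmul]
  rw [← h]
  refine Finset.sum_congr rfl fun j _ => ?_
  rw [Finset.smul_sum]
  refine Finset.sum_congr rfl fun b _ => ?_
  rw [smul_smul, ← Finset.mul_prod_erase _ _ (Finset.mem_univ k), mul_comm,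
    Function.update_self]
  congr 2
  refine Finset.prod_congr rfl fun l hl => ?_
  rw [Function.update_of_ne (Finset.ne_of_mem_erase hl)]

/-- If each matrix `P k` fixes `G` in mode `k`, then so does their joint Tucker product. -/
theorem sum_prod_smul_eq_self {ι H : Type*} [Fintype ι] [DecidableEq ι] {α : ι → Type*}
    [∀ l, Fintype (α l)] [∀ l, DecidableEq (α l)] [AddCommGroup H] [Module ℝ H]
    (P : ∀ l, Matrix (α l) (α l) ℝ) (G : (∀ l, α l) → H)
    (hP : ∀ k a j, ∑ b, P k a b • G (Function.update j k b) = G (Function.update j k a))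
    (i : ∀ l, α l) :
    ∑ j, (∏ l, P l (i l) (j l)) • G j = G i := by
  suffices h : ∀ S : Finset ι,
      ∑ j, (∏ l, (if l ∈ S then P l else 1) (i l) (j l)) • G j = G i by
    simpa using h Finset.univ
  intro S
  induction S using Finset.induction_on with
  | empty =>
    rw [Finset.sum_eq_single i]
    · simp
    · intro j _ hj
      obtain ⟨l, hl⟩ := Function.ne_iff.mp hj
      rw [Finset.prod_eq_zero (Finset.mem_univ l), zero_smul]
      simp [Matrix.one_apply_ne hl.symm]
    · simp
  | insert k S hk ih =>
    rw [← ih]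
    have hcard : (Fintype.card (α k) : ℝ) ≠ 0 :=
      Nat.cast_ne_zero.mpr (Fintype.card_pos_iff.mpr ⟨i k⟩).ne'
    apply smul_right_injective H hcard
    dsimp only
    rw [card_smul_sum_prod_smul k
        (fun l => (if l ∈ insert k S then P l else 1) (i l)),
      card_smul_sum_prod_smul k (fun l => (if l ∈ S then P l else 1) (i l))]
    refine Finset.sum_congr rfl fun j _ => ?_
    congr 1
    · refine Finset.prod_congr rfl fun l hl => ?_
      simp [Finset.mem_insert, Finset.ne_of_mem_erase hl]
    · simp [hk, hP, Matrix.one_apply]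

theorem l2Norm_eq_zero {H S : Type*} [NormedAddCommGroup H] [Fintype S] {v : S → H} :
    l2Norm v = 0 ↔ v = 0 := by
  rw [l2Norm, Real.sqrt_eq_zero (Finset.sum_nonneg fun _ _ => sq_nonneg _),
    Finset.sum_eq_zero_iff_of_nonneg fun _ _ => sq_nonneg _]
  simp [funext_iff]

/-- If a linear map sends the span of the mode-`k` slices of `A` onto a space containing the
mode-`k` slices of `B`, then the mode-`k` rank of `B` is at most that of `A`. -/
theorem modeRank_le_of_mem_map {H : Type*} [NormedAddCommGroup H] [InnerProductSpace ℝ H]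
    {d : ℕ} {n m : Fin d → ℕ} {A : (∀ k, Fin (n k)) → H} {B : (∀ k, Fin (m k)) → H} {k : Fin d}
    (L : ((∀ l, Fin (n l)) → H) →ₗ[ℝ] ((∀ l, Fin (m l)) → H))
    (hL : ∀ b : Fin (m k), (fun i => B (Function.update i k b)) ∈
      (Submodule.span ℝ (Set.range fun (a : Fin (n k)) (i : ∀ l, Fin (n l)) =>
        A (Function.update i k a))).map L) :
    modeRank B k ≤ modeRank A k := by
  unfold modeRank
  have : FiniteDimensional ℝ (Submodule.span ℝ
      (Set.range fun (a : Fin (n k)) (i : ∀ l, Fin (n l)) => A (Function.update i k a))) :=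
    FiniteDimensional.span_of_finite ℝ (Set.finite_range _)
  refine (Submodule.finrank_mono (Submodule.span_le.mpr ?_)).trans
    (Submodule.finrank_map_le L _)
  rintro _ ⟨b, rfl⟩
  exact hL b

/-- A Tucker product with core `G` has mode-`k` rank at most that of `G`. -/
theorem modeRank_tucker_le {H : Type*} [NormedAddCommGroup H] [InnerProductSpace ℝ H]
    {d : ℕ} {n m : Fin d → ℕ} (F : ∀ k, Matrix (Fin (n k)) (Fin (m k)) ℝ)
    (G : (∀ k, Fin (m k)) → H) (k : Fin d) (hk : m k ≠ 0) :
    modeRank (fun i => ∑ j, (∏ l, F l (i l) (j l)) • G j) k ≤ modeRank G k := by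
  let L : ((∀ l, Fin (m l)) → H) →ₗ[ℝ] ((∀ l, Fin (n l)) → H) :=
    LinearMap.pi fun i => (m k : ℝ)⁻¹ •
      ∑ j, (∏ l ∈ Finset.univ.erase k, F l (i l) (j l)) • LinearMap.proj j
  refine modeRank_le_of_mem_map L fun a => ?_
  refine ⟨∑ b, F k a b • fun j => G (Function.update j k b),
    Submodule.sum_mem _ fun b _ => Submodule.smul_mem _ _ (Submodule.subset_span ⟨b, rfl⟩), ?_⟩
  funext i
  have h := card_smul_sum_prod_smul k (fun l => F l (Function.update i k a l)) G
  rw [Fintype.card_fin, ← eq_inv_smul_iff₀ (Nat.cast_ne_zero.mpr hk)] at h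
  rw [h]
  simp only [L, LinearMap.pi_apply, LinearMap.smul_apply, LinearMap.sum_apply,
    LinearMap.proj_apply, Finset.sum_apply, Pi.smul_apply, Function.update_self]
  congr 1
  refine Finset.sum_congr rfl fun j _ => ?_
  congr 1
  refine Finset.prod_congr rfl fun l hl => ?_
  rw [Function.update_of_ne (Finset.ne_of_mem_erase hl)]

/-- A subtensor has mode-`k` rank at most that of the whole tensor. -/
theorem modeRank_subtensor_le {H : Type*} [NormedAddCommGroup H] [InnerProductSpace ℝ H]
    {d : ℕ} {n m : Fin d → ℕ} (B : (∀ k, Fin (n k)) → H)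
    (I : ∀ k, Fin (m k) → Fin (n k)) (k : Fin d) :
    modeRank (fun j : ∀ l, Fin (m l) => B (fun l => I l (j l))) k ≤ modeRank B k := by
  refine modeRank_le_of_mem_map (LinearMap.funLeft ℝ H fun j l => I l (j l)) fun b => ?_
  refine ⟨_, Submodule.subset_span ⟨I k b, rfl⟩, ?_⟩
  funext j
  simp only [LinearMap.funLeft_apply]
  congr 1
  funext l
  exact (Function.apply_update I j k b l).symm

/-- **A Tucker-cross approximation interpolates the core and preserves its Tucker rank.**
If `B` is a Tucker-cross approximation of `A` at injective index maps `I k` (with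
`m k ≥ 1`), then `B` agrees with `A` on the selected subgrid, and for every mode `k` the
mode-`k` rank of `B` equals the mode-`k` rank of the subtensor `G`. -/
theorem tuckerCrossApprox_core_interp {H : Type*} [NormedAddCommGroup H]
    [InnerProductSpace ℝ H] {d : ℕ} {n m : Fin d → ℕ}
    (A : (∀ k : Fin d, Fin (n k)) → H)
    (I : ∀ k : Fin d, Fin (m k) → Fin (n k))
    (hm : ∀ k : Fin d, 1 ≤ m k)
    (hI : ∀ k : Fin d, Function.Injective (I k))
    (G : (∀ k : Fin d, Fin (m k)) → H)
    (hG : ∀ j : ∀ k : Fin d, Fin (m k), G j = A (fun k => I k (j k)))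
    (B : (∀ k : Fin d, Fin (n k)) → H)
    (hB : IsTuckerCrossApprox A I B) :
    (∀ j : ∀ k : Fin d, Fin (m k), B (fun k => I k (j k)) = G j) ∧
    (∀ k : Fin d, modeRank B k = modeRank G k) := by
  obtain ⟨F, hF, hBF⟩ := hB
  obtain rfl : G = fun j => A (fun k => I k (j k)) := funext hG
  obtain rfl := funext hBF
  have hfix : ∀ (k : Fin d) (a : Fin (m k)) (j : ∀ l, Fin (m l)),
      ∑ b, F k (I k a) b • A (fun l => I l (Function.update j k b l)) =
        A (fun l => I l (Function.update j k a l)) := by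
    intro k a j
    have hupd : ∀ j : ∀ l, Fin (m l),
        (fun l => I l (Function.update j k a l)) =
          Function.update (fun l => I l (j l)) k (I k a) :=
      fun j => funext (Function.apply_update I j k a)
    have hle := (hF k (I k a) (Pi.single a 1)).trans_eq
      (l2Norm_eq_zero.mpr (by funext j; simp [Pi.single_apply, hupd]))
    have h := l2Norm_eq_zero.mp (hle.antisymm (Real.sqrt_nonneg _))
    rw [hupd]
    exact sub_eq_zero.mp (congrFun h j)
  have hinterp : ∀ j : ∀ k, Fin (m k),
      ∑ j' : ∀ l, Fin (m l), (∏ k, F k (I k (j k)) (j' k)) • A (fun l => I l (j' l)) =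
        A (fun k => I k (j k)) :=
    sum_prod_smul_eq_self (fun k => (F k).submatrix (I k) id) _ hfix
  refine ⟨hinterp, fun k => le_antisymm ?_ ?_⟩
  · exact modeRank_tucker_le F (fun j => A (fun l => I l (j l))) k
      (Nat.one_le_iff_ne_zero.mp (hm k))
  · have h := modeRank_subtensor_le (fun i => ∑ j : ∀ l, Fin (m l),
      (∏ k, F k (i k) (j k)) • A (fun l => I l (j l))) I k
    simpa only [hinterp] using h
end

section
/- Let A be a function-valued tensor of size n over H, let I k : Fin (m k) → Fin (n k) be injective index maps (with m k ≥ 1), let G be the subtensor G j = A (fun k => I k (j k)), and let B be any Tucker-cross approximation of A at (I₁,…,I_d). Then B = A (as tensors, i.e., B i = A i for every multi-index i) if and only if for every k : Fin d the mode-k rank of G equals the mode-k rank of A. -/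
section TuckerContraction

variable {ι H : Type*} [Fintype ι] [DecidableEq ι] {κ : ι → Type*} [∀ i, Fintype (κ i)]

/-- Summing `f` over all updates in one coordinate counts every value `card (κ k)` times. -/
lemma sum_sum_update [AddCommMonoid H] (f : (∀ i, κ i) → H) (k : ι) :
    ∑ j, ∑ b, f (Function.update j k b) = Fintype.card (κ k) • ∑ j, f j := by
  let e : (∀ i, κ i) × κ k ≃ (∀ i, κ i) × κ k :=
    { toFun := fun p => (Function.update p.1 k p.2, p.1 k)
      invFun := fun p => (Function.update p.1 k p.2, p.1 k)
      left_inv := fun p => by simp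
      right_inv := fun p => by simp }
  calc ∑ j, ∑ b, f (Function.update j k b)
      = ∑ p : (∀ i, κ i) × κ k, f (e p).1 := by rw [Fintype.sum_prod_type]; rfl
    _ = ∑ p : (∀ i, κ i) × κ k, f p.1 := e.sum_comp fun p => f p.1
    _ = Fintype.card (κ k) • ∑ j, f j := by
      simp [Fintype.sum_prod_type, Finset.smul_sum]

variable [AddCommGroup H] [Module ℝ H]

/-- Contraction of the tensor `T` with one vector in every mode. -/
noncomputable def tuckerContraction (T : (∀ i, κ i) → H) :
    MultilinearMap ℝ (fun i => κ i → ℝ) H :=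
  ∑ j, ((MultilinearMap.mkPiAlgebra ℝ ι ℝ).compLinearMap
    fun i => LinearMap.proj (j i)).smulRight (T j)

lemma tuckerContraction_apply (T : (∀ i, κ i) → H) (v : ∀ i, κ i → ℝ) :
    tuckerContraction T v = ∑ j, (∏ i, v i (j i)) • T j := by
  simp [tuckerContraction]

lemma tuckerContraction_single [∀ i, DecidableEq (κ i)] (T : (∀ i, κ i) → H) (i : ∀ i, κ i) :
    tuckerContraction T (fun l => Pi.single (i l) 1) = T i := by
  rw [tuckerContraction_apply, Finset.sum_eq_single i]
  · simp
  · intro j _ hj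
    obtain ⟨l, hl⟩ := Function.ne_iff.1 hj
    rw [Finset.prod_eq_zero (Finset.mem_univ l) (Pi.single_eq_of_ne hl 1), zero_smul]
  · simp

/-- If `x` is a linear relation between the mode-`k` slices of `T`, then contracting `T` with `x`
in mode `k` gives zero. -/
lemma tuckerContraction_update_eq_zero (T : (∀ i, κ i) → H) (k : ι) (x : κ k → ℝ)
    (hx : ∀ j, ∑ b, x b • T (Function.update j k b) = 0) (v : ∀ i, κ i → ℝ) :
    tuckerContraction T (Function.update v k x) = 0 := by
  rw [tuckerContraction_apply]
  cases isEmpty_or_nonempty (κ k) with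
  | inl h =>
    have : IsEmpty (∀ i, κ i) := ⟨fun j => h.elim (j k)⟩
    simp
  | inr h =>
    have key := sum_sum_update
      (fun j => (∏ i, Function.update v k x i (j i)) • T j) k
    have hz : ∀ j : ∀ i, κ i, ∑ b, (∏ i, Function.update v k x i (Function.update j k b i)) •
        T (Function.update j k b) = 0 := by
      intro j
      have hprod : ∀ b, ∏ i, Function.update v k x i (Function.update j k b i) =
          (∏ i ∈ Finset.univ.erase k, v i (j i)) * x b := by
        intro b
        rw [← Finset.prod_erase_mul _ _ (Finset.mem_univ k)]
        congr 1
        · refine Finset.prod_congr rfl fun i hi => ?_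
          rw [Function.update_of_ne (Finset.ne_of_mem_erase hi),
            Function.update_of_ne (Finset.ne_of_mem_erase hi)]
        · simp
      simp_rw [hprod, mul_smul, ← Finset.smul_sum, hx, smul_zero]
    rw [Finset.sum_congr rfl fun j _ => hz j, Finset.sum_const_zero,
      ← Nat.cast_smul_eq_nsmul ℝ] at key
    exact (smul_eq_zero.1 key.symm).resolve_left (by simp)

end TuckerContraction

lemma MultilinearMap.map_eq_of_update_eq {R ι N : Type*} {M : ι → Type*} [Fintype ι]
    [DecidableEq ι] [Semiring R] [∀ i, AddCommMonoid (M i)] [AddCommMonoid N]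
    [∀ i, Module R (M i)] [Module R N] (f : MultilinearMap R M N) (v w : ∀ i, M i)
    (h : ∀ k u, f (Function.update u k (w k)) = f (Function.update u k (v k))) : f w = f v := by
  have key : ∀ s : Finset ι, f (s.piecewise w v) = f v := by
    intro s
    induction s using Finset.induction_on with
    | empty => simp
    | insert k s hk ih =>
      rw [Finset.piecewise_insert, h, ← ih]
      congr 1
      rw [Function.update_eq_self_iff, Finset.piecewise_eq_of_notMem _ _ _ hk]
  simpa using key Finset.univ

section Restriction

variable {H : Type*} [NormedAddCommGroup H]

lemma l2Norm_le_zero_iff {S : Type*} [Fintype S] (v : S → H) :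
    l2Norm v ≤ 0 ↔ ∀ s, v s = 0 := by
  rw [l2Norm, Real.sqrt_le_left le_rfl, zero_pow two_ne_zero,
    (Finset.sum_nonneg fun s _ => sq_nonneg ‖v s‖).ge_iff_eq',
    Finset.sum_eq_zero_iff_of_nonneg fun s _ => sq_nonneg ‖v s‖]
  simp

variable [InnerProductSpace ℝ H] {d : ℕ} {n m : Fin d → ℕ}

/-- The mode-`k` slice of `A` at `a`. -/
def modeSlice (A : (∀ k, Fin (n k)) → H) (k : Fin d) (a : Fin (n k)) : (∀ l, Fin (n l)) → H :=
  fun i => A (Function.update i k a)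

/-- Restriction of a tensor to the index maps `I`. -/
def restrictTensor (I : ∀ k, Fin (m k) → Fin (n k)) :
    ((∀ k, Fin (n k)) → H) →ₗ[ℝ] ((∀ k, Fin (m k)) → H) :=
  LinearMap.funLeft ℝ H fun j k => I k (j k)

lemma restrictTensor_modeSlice (A : (∀ k, Fin (n k)) → H) (I : ∀ k, Fin (m k) → Fin (n k))
    (k : Fin d) (b : Fin (m k)) :
    restrictTensor I (modeSlice A k (I k b)) = modeSlice (restrictTensor I A) k b := by
  funext j
  simp only [restrictTensor, LinearMap.funLeft_apply, modeSlice]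
  congr 1
  funext l
  exact (Function.apply_update I j k b l).symm

lemma span_modeSlice_restrictTensor_le (A : (∀ k, Fin (n k)) → H)
    (I : ∀ k, Fin (m k) → Fin (n k)) (k : Fin d) :
    Submodule.span ℝ (Set.range (modeSlice (restrictTensor I A) k)) ≤
      (Submodule.span ℝ (Set.range (modeSlice A k))).map (restrictTensor I) := by
  rw [Submodule.span_le, Set.range_subset_iff]
  intro b
  rw [← restrictTensor_modeSlice]
  exact Submodule.mem_map_of_mem (Submodule.subset_span ⟨_, rfl⟩)

instance (A : (∀ k, Fin (n k)) → H) (k : Fin d) :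
    FiniteDimensional ℝ (Submodule.span ℝ (Set.range (modeSlice A k))) :=
  FiniteDimensional.span_of_finite ℝ (Set.finite_range _)

lemma modeRank_restrictTensor_le (A : (∀ k, Fin (n k)) → H) (I : ∀ k, Fin (m k) → Fin (n k))
    (k : Fin d) : modeRank (restrictTensor I A) k ≤ modeRank A k :=
  (Submodule.finrank_mono (span_modeSlice_restrictTensor_le A I k)).trans
    (Submodule.finrank_map_le _ _)

/-- A Tucker product with core `G` has mode ranks at most those of `G`. -/
lemma modeRank_le_of_eq_tuckerContraction (A : (∀ k, Fin (n k)) → H) (G : (∀ k, Fin (m k)) → H)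
    (F : ∀ k, Matrix (Fin (n k)) (Fin (m k)) ℝ)
    (h : ∀ i, A i = tuckerContraction G fun k => F k (i k)) (k : Fin d) :
    modeRank A k ≤ modeRank G k := by
  let K := Fintype.linearCombination ℝ (modeSlice G k)
  let L : (Fin (m k) → ℝ) →ₗ[ℝ] ((∀ l, Fin (n l)) → H) :=
    LinearMap.pi fun i => (tuckerContraction G).toLinearMap (fun l => F l (i l)) k
  have hker : LinearMap.ker K ≤ LinearMap.ker L := by
    intro x hx
    rw [LinearMap.mem_ker] at hx ⊢
    funext i
    refine tuckerContraction_update_eq_zero G k x (fun j => ?_) _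
    simpa [K, Fintype.linearCombination_apply, modeSlice] using congrFun hx j
  have hrange : Submodule.span ℝ (Set.range (modeSlice A k)) ≤ LinearMap.range L := by
    rw [Submodule.span_le, Set.range_subset_iff]
    refine fun a => ⟨F k a, funext fun i => ?_⟩
    simp only [modeSlice, h]
    change tuckerContraction G (Function.update _ k (F k a)) = _
    congr 1
    funext l
    exact (Function.apply_update (fun l => F l) i k a l).symm
  have hK : LinearMap.range K = Submodule.span ℝ (Set.range (modeSlice G k)) :=
    Fintype.range_linearCombination ℝ (modeSlice G k)
  have h₁ := L.finrank_range_add_finrank_ker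
  have h₂ := K.finrank_range_add_finrank_ker
  have h₃ := Submodule.finrank_mono hker
  have h₄ : modeRank A k ≤ Module.finrank ℝ (LinearMap.range L) := Submodule.finrank_mono hrange
  have h₅ : modeRank G k = Module.finrank ℝ (LinearMap.range K) := by rw [hK]; rfl
  lia

/-- If restriction preserves the mode-`k` rank, then it is injective on the span of the mode-`k`
slices and maps it onto the span of the restricted slices. -/
lemma injOn_and_map_eq_of_modeRank_eq (A : (∀ k, Fin (n k)) → H)
    (I : ∀ k, Fin (m k) → Fin (n k)) (k : Fin d)
    (h : modeRank (restrictTensor I A) k = modeRank A k) :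
    Set.InjOn (restrictTensor I) (SetLike.coe (Submodule.span ℝ (Set.range (modeSlice A k)))) ∧
      (Submodule.span ℝ (Set.range (modeSlice A k))).map (restrictTensor I) =
        Submodule.span ℝ (Set.range (modeSlice (restrictTensor I A) k)) := by
  set W := Submodule.span ℝ (Set.range (modeSlice A k))
  have hle : _ ≤ W.map _ := span_modeSlice_restrictTensor_le A I k
  have hmap : Module.finrank ℝ (W.map (restrictTensor I)) ≤ Module.finrank ℝ W :=
    Submodule.finrank_map_le _ _
  have hspan : Module.finrank ℝ (Submodule.span ℝ (Set.range (modeSlice (restrictTensor I A) k)))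
      = Module.finrank ℝ W := h
  have heq := Submodule.eq_of_le_of_finrank_le hle (by rw [hspan]; exact hmap)
  refine ⟨?_, heq.symm⟩
  have hrk := ((restrictTensor I).domRestrict W).finrank_range_add_finrank_ker
  rw [LinearMap.range_domRestrict, ← heq, hspan] at hrk
  have hker : LinearMap.ker ((restrictTensor (H := H) I).domRestrict W) = ⊥ :=
    Submodule.finrank_eq_zero.1 (by lia)
  exact Set.injOn_iff_injective.2 (LinearMap.ker_eq_bot.1 hker)

/-- Equality of the mode-`k` ranks makes least-squares coefficients interpolate every slice. -/
lemma modeSlice_eq_sum_of_isMin (A : (∀ k, Fin (n k)) → H)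
    (I : ∀ k, Fin (m k) → Fin (n k)) (k : Fin d)
    (h : modeRank (restrictTensor I A) k = modeRank A k) (a : Fin (n k)) (y : Fin (m k) → ℝ)
    (hy : ∀ x : Fin (m k) → ℝ,
      l2Norm (∑ b, y b • modeSlice (restrictTensor I A) k b - restrictTensor I (modeSlice A k a)) ≤
      l2Norm (∑ b, x b • modeSlice (restrictTensor I A) k b -
        restrictTensor I (modeSlice A k a))) :
    modeSlice A k a = ∑ b, y b • modeSlice A k (I k b) := by
  obtain ⟨hinj, hmap⟩ := injOn_and_map_eq_of_modeRank_eq A I k h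
  have hmem : ∀ a, modeSlice A k a ∈ Submodule.span ℝ (Set.range (modeSlice A k)) :=
    fun a => Submodule.subset_span ⟨a, rfl⟩
  have ha := Submodule.mem_map_of_mem (f := restrictTensor I) (hmem a)
  rw [hmap, Submodule.mem_span_range_iff_exists_fun] at ha
  obtain ⟨x, hx⟩ := ha
  have hz := (l2Norm_le_zero_iff _).1 ((hy x).trans ((l2Norm_le_zero_iff _).2 (by simp [hx])))
  refine hinj (hmem a) (Submodule.sum_mem _ fun b _ => Submodule.smul_mem _ _ (hmem _)) ?_
  simp only [map_sum, map_smul, restrictTensor_modeSlice]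
  exact (sub_eq_zero.1 (funext hz)).symm

/-- A tensor all of whose slices are combinations of the slices at `I` is the Tucker product of
its restriction with the coefficient matrices. -/
lemma eq_tuckerContraction_of_modeSlice_eq (A : (∀ k, Fin (n k)) → H)
    (I : ∀ k, Fin (m k) → Fin (n k)) (F : ∀ k, Matrix (Fin (n k)) (Fin (m k)) ℝ)
    (h : ∀ k a, modeSlice A k a = ∑ b, F k a b • modeSlice A k (I k b)) (i : ∀ k, Fin (n k)) :
    A i = tuckerContraction (restrictTensor I A) fun k => F k (i k) := by
  let w : ∀ k, Fin (n k) → ℝ := fun k => ∑ b, F k (i k) b • Pi.single (I k b) 1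
  calc A i = tuckerContraction A (fun k => Pi.single (i k) 1) := (tuckerContraction_single A i).symm
    _ = tuckerContraction A w := by
      refine MultilinearMap.map_eq_of_update_eq _ _ _ fun k u => ?_
      rw [← sub_eq_zero, ← MultilinearMap.map_update_sub]
      refine tuckerContraction_update_eq_zero A k _ (fun j => ?_) u
      have hj := congrFun (h k (i k)) j
      simp only [modeSlice, Finset.sum_apply, Pi.smul_apply] at hj
      simp only [Pi.sub_apply, sub_smul, Finset.sum_sub_distrib, w, Finset.sum_apply,
        Pi.smul_apply, smul_eq_mul, Finset.sum_smul, mul_smul]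
      rw [Finset.sum_comm]
      simp [Pi.single_apply, ite_smul, hj]
    _ = ∑ j : ∀ k, Fin (m k), (∏ k, F k (i k) (j k)) •
        tuckerContraction A (fun k => Pi.single (I k (j k)) 1) := by
      rw [MultilinearMap.map_sum]
      exact Finset.sum_congr rfl fun j _ => MultilinearMap.map_smul_univ _ _ _
    _ = _ := by
      rw [tuckerContraction_apply]
      exact Finset.sum_congr rfl fun j _ => by rw [tuckerContraction_single]; rfl

end Restriction

/-- **Exactness criterion for Tucker-cross approximations.**
Let `B` be a Tucker-cross approximation of `A` at injective index maps `I k` (with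
`m k ≥ 1`), with subtensor `G j = A (fun k => I k (j k))`. Then `B = A` if and only if for
every mode `k` the mode-`k` rank of `G` equals the mode-`k` rank of `A`. -/
theorem tuckerCrossApprox_exact_iff {H : Type*} [NormedAddCommGroup H]
    [InnerProductSpace ℝ H] {d : ℕ} {n m : Fin d → ℕ}
    (A : (∀ k : Fin d, Fin (n k)) → H)
    (I : ∀ k : Fin d, Fin (m k) → Fin (n k))
    (hm : ∀ k : Fin d, 1 ≤ m k)
    (hI : ∀ k : Fin d, Function.Injective (I k))
    (G : (∀ k : Fin d, Fin (m k)) → H)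
    (hG : ∀ j : ∀ k : Fin d, Fin (m k), G j = A (fun k => I k (j k)))
    (B : (∀ k : Fin d, Fin (n k)) → H)
    (hB : IsTuckerCrossApprox A I B) :
    (∀ i : ∀ k : Fin d, Fin (n k), B i = A i) ↔
    (∀ k : Fin d, modeRank G k = modeRank A k) := by
  obtain ⟨F, hF, hBF⟩ := hB
  obtain rfl : G = restrictTensor I A := funext hG
  have hBF' : ∀ i, B i = tuckerContraction (restrictTensor I A) fun k => F k (i k) := fun i => by
    rw [hBF, tuckerContraction_apply]
    rfl
  constructor
  · intro hBA k
    exact (modeRank_restrictTensor_le A I k).antisymm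
      (modeRank_le_of_eq_tuckerContraction A _ F (fun i => by rw [← hBA, hBF']) k)
  · intro hrank i
    rw [hBF', ← eq_tuckerContraction_of_modeSlice_eq A I F]
    intro k a
    refine modeSlice_eq_sum_of_isMin A I k (hrank k) a (F k a) fun x => ?_
    have hfun : ∀ y : Fin (m k) → ℝ,
        ∑ b, y b • modeSlice (restrictTensor I A) k b - restrictTensor I (modeSlice A k a) =
        fun j => (∑ b, y b • A (fun l => I l (Function.update j k b l))) -
          A (Function.update (fun l => I l (j l)) k a) := by
      intro y
      funext j
      simp only [Pi.sub_apply, Finset.sum_apply, Pi.smul_apply]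
      rfl
    rw [hfun, hfun]
    exact hF k a x
end
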